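/- Fix real constants m, a and c ≠ 0, and let I ⊆ ℝ be a nonempty open interval such that τ > 0, τ − c > 0 and τ − 2c > 0 for every τ ∈ I. If φ : I → ℝ is twice continuously differentiable and satisfies the homogeneous versions of both (S1) and (S2) at every point of I, then there exists a real constant C such that φ(τ) = C·(τ−2c)^{1−a}·(τ−c)^{−m}·τ^{2m−1+a} for every τ ∈ I. -/

import Mathlib

/-- ψ(τ) = (τ−2c)^{1−a}·(τ−c)^{−m}·τ^{2m−1+a}, with real powers. -/
noncomputable def psiFun (m a c : ℝ) : ℝ → ℝ := fun τ =>
  (τ - 2*c) ^ (1 - a) * (τ - c) ^ (-m) * τ ^ (2*m - 1 + a)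

/-- The logarithmic derivative of `psiFun` where all three bases are positive. -/
lemma hasDerivAt_psiFun (m a c : ℝ) {τ : ℝ} (h0 : 0 < τ) (h1 : 0 < τ - c)
    (h2 : 0 < τ - 2*c) :
    HasDerivAt (psiFun m a c)
      (psiFun m a c τ * ((1 - a) / (τ - 2*c) - m / (τ - c) + (2*m - 1 + a) / τ)) τ := by
  have d2 := ((hasDerivAt_id τ).sub_const (2*c)).rpow_const (p := 1 - a) (Or.inl h2.ne')
  have d1 := ((hasDerivAt_id τ).sub_const c).rpow_const (p := -m) (Or.inl h1.ne')
  have d0 := (hasDerivAt_id τ).rpow_const (p := 2*m - 1 + a) (Or.inl h0.ne')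
  refine ((d2.mul d1).mul d0).congr_deriv ?_
  simp only [id, psiFun, Pi.mul_apply]
  rw [Real.rpow_sub_one h2.ne', Real.rpow_sub_one h1.ne', Real.rpow_sub_one h0.ne']
  field_simp
  ring

lemma psiFun_pos (m a c : ℝ) {τ : ℝ} (h0 : 0 < τ) (h1 : 0 < τ - c) (h2 : 0 < τ - 2*c) :
    0 < psiFun m a c τ := by
  unfold psiFun
  positivity

/-- Any C² solution of the homogeneous versions of both (S1) and (S2) on an
interval where τ, τ−c and τ−2c are positive is a constant multiple of ψ. -/
theorem homogeneous_solutions_are_multiples_of_psi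
    (m a c : ℝ) (hc : c ≠ 0)
    (I : Set ℝ) (hIopen : IsOpen I) (hIconn : I.OrdConnected) (hIne : I.Nonempty)
    (hpos : ∀ τ ∈ I, 0 < τ ∧ 0 < τ - c ∧ 0 < τ - 2*c)
    (φ : ℝ → ℝ) (hφ : ContDiffOn ℝ 2 φ I)
    (hS1 : ∀ τ ∈ I,
      τ*(τ-c)^2*(2*c-τ) * deriv (deriv φ) τ
        + ((m-2)*τ^3 + c*(8-5*m-2*a)*τ^2 + 2*c^2*(2*a+4*m-5)*τ
            - 2*c^3*(2*m-2+a)) * deriv φ τ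
        + m*τ*(τ-2*c) * φ τ = 0)
    (hS2 : ∀ τ ∈ I,
      τ^2*(τ-c)*(2*c-τ) * deriv (deriv φ) τ
        + ((m-1)*τ^3 + 2*c*(1-2*m-a)*τ^2 + 2*c^2*(a+2*m)*τ) * deriv φ τ
        + 2*c*(a+2*m-1)*(τ-2*c) * φ τ = 0) :
    ∃ C : ℝ, ∀ τ ∈ I, φ τ = C * psiFun m a c τ := by
  have hderiv : ∀ τ ∈ I, HasDerivAt (fun t => φ t / psiFun m a c t) 0 τ := by
    intro τ hτ
    obtain ⟨h0, h1, h2⟩ := hpos τ hτ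
    have hψ := (psiFun_pos m a c h0 h1 h2).ne'
    have hd : HasDerivAt φ (deriv φ τ) τ :=
      ((hφ.differentiableOn (by norm_num)).differentiableAt (hIopen.mem_nhds hτ)).hasDerivAt
    refine (hd.div (hasDerivAt_psiFun m a c h0 h1 h2) hψ).congr_deriv ?_
    have first_order : τ * (τ - c) * (τ - 2*c) * deriv φ τ
        = (m * τ^2 - 2*c*(a + 2*m - 1)*(τ - c)) * φ τ := by
      apply mul_left_cancel₀ h2.ne'
      linear_combination (τ - c) * hS2 τ hτ - τ * hS1 τ hτ
    have log_deriv : deriv φ τ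
        = φ τ * ((1 - a) / (τ - 2*c) - m / (τ - c) + (2*m - 1 + a) / τ) := by
      field_simp
      linear_combination first_order
    rw [log_deriv]
    ring
  obtain ⟨x, hx⟩ := hIne
  refine ⟨φ x / psiFun m a c x, fun τ hτ => ?_⟩
  obtain ⟨h0, h1, h2⟩ := hpos τ hτ
  rw [← div_eq_iff (psiFun_pos m a c h0 h1 h2).ne']
  exact hIopen.is_const_of_deriv_eq_zero hIconn.isPreconnected
    (fun t ht => (hderiv t ht).differentiableAt.differentiableWithinAt)
    (fun t ht => (hderiv t ht).deriv) hτ hx
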